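/- Let N = 2, suppose q := q_{1,2} is not a root of unity, and let λ_1, λ_2 ∈ k be roots of unity that are not both equal to 1. Let g be the algebra automorphism of A = S_q(V) with g(x_i) = λ_i x_i, and A_g the correspondingly twisted A^e-module. Then Ext^0_{A^e}(A, A_g) = 0, Ext^1_{A^e}(A, A_g) = 0, Ext^2_{A^e}(A, A_g) is one-dimensional over k (spanned by the class of (1 # g) ⊗ x_1*∧x_2*), and Ext^m_{A^e}(A, A_g) = 0 for all m ≥ 3. -/

import Mathlib

attribute [local instance] Classical.propDecidable

set_option synthInstance.maxHeartbeats 1000000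
set_option maxHeartbeats 1000000

noncomputable section

open scoped TensorProduct
open CategoryTheory

section QSA
variable (k : Type) [Field k] (N : ℕ) (q : Fin N → Fin N → k)

inductive QRel : FreeAlgebra k (Fin N) → FreeAlgebra k (Fin N) → Prop
  | rel (i j : Fin N) : QRel (FreeAlgebra.ι k i * FreeAlgebra.ι k j)
      (q i j • (FreeAlgebra.ι k j * FreeAlgebra.ι k i))

abbrev QSA := RingQuot (QRel k N q)

def X (i : Fin N) : QSA k N q := RingQuot.mkAlgHom k (QRel k N q) (FreeAlgebra.ι k i)

abbrev QSAe := QSA k N q ⊗[k] (QSA k N q)ᵐᵒᵖ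

instance : Module (QSAe k N q) (QSA k N q) := TensorProduct.Algebra.module

variable (lam : Fin N → k)

/-- The diagonal algebra automorphism `g` of `S_q(V)` with `g(x_i) = λ_i x_i`. -/
def gAlg : QSA k N q →ₐ[k] QSA k N q :=
  RingQuot.liftAlgHom k
    ⟨FreeAlgebra.lift k (fun i => lam i • X k N q i), by
      intro x y h
      induction h with
      | rel i j =>
        have hrel : (X k N q i) * (X k N q j) = q i j • ((X k N q j) * (X k N q i)) := by
          simpa only [X, map_mul, map_smul] using
            RingQuot.mkAlgHom_rel k (QRel.rel (k := k) (N := N) (q := q) i j)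
        simp only [map_mul, map_smul, FreeAlgebra.lift_ι_apply]
        rw [smul_mul_smul_comm, hrel, smul_smul]
        rw [smul_mul_smul_comm, smul_smul]
        congr 1
        ring⟩

/-- The algebra endomorphism `a ⊗ b^{op} ↦ a ⊗ (g b)^{op}` of `A^e`. -/
def taug : QSAe k N q →ₐ[k] QSAe k N q :=
  Algebra.TensorProduct.map (AlgHom.id k (QSA k N q)) (AlgHom.op (gAlg k N q lam))

/-- The twisted bimodule `A_g`: as a vector space it is `A`, with `A^e`-action
`(a ⊗ b^{op}) · c = a c g(b)`. -/
def Ag (lam : Fin N → k) : Type := QSA k N q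

instance : AddCommGroup (Ag k N q lam) := inferInstanceAs (AddCommGroup (QSA k N q))

instance : Module (QSAe k N q) (Ag k N q lam) :=
  Module.compHom (QSA k N q) (taug k N q lam).toRingHom

end QSA


section CgDef
variable (k : Type) [Field k] (N : ℕ) (q : Fin N → Fin N → k) (lam : Fin N → k)

/-- A subset `β ⊆ {1,…,N}`, considered as a `{0,1}`-vector in `ℤ^N`. -/
def betaZ (S : Finset (Fin N)) : Fin N → ℤ := fun s => if s ∈ S then 1 else 0

/-- The set `C_g = {γ ∈ (ℕ ∪ {-1})^N : for each i, ∏_s q_{i,s}^{γ_s} = λ_i or γ_i = -1}`. -/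
def Cg : Set (Fin N → ℤ) :=
  {γ | ∀ i : Fin N, (∏ s, q i s ^ γ s) = lam i ∨ γ i = -1}

/-- The Hochschild cohomology `HH^m(S_q(V), A_g) = Ext^m_{A^e}(A, A_g)`, as a
`k`-vector space (`Ext` taken in the category of left `A^e`-modules). -/
def HHg (m : ℕ) : ModuleCat k :=
  ((Ext k (ModuleCat (QSAe k N q)) m).obj
    (Opposite.op (ModuleCat.of (QSAe k N q) (QSA k N q)))).obj
    (ModuleCat.of (QSAe k N q) (Ag k N q lam))

end CgDef

section KosCat
universe v u
variable {C : Type u} [Category.{v} C] [Abelian C]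

open Limits ZeroObject

def kosX (P0 P1 P2 : C) : ℕ → C
  | 0 => P0
  | 1 => P1
  | 2 => P2
  | _ + 3 => 0

def kosd {P0 P1 P2 : C} (d2 : P2 ⟶ P1) (d1 : P1 ⟶ P0) :
    ∀ n, kosX P0 P1 P2 (n + 1) ⟶ kosX P0 P1 P2 n
  | 0 => d1
  | 1 => d2
  | _ + 2 => (0 : (0 : C) ⟶ _)

lemma kosd_sq {P0 P1 P2 : C} (d2 : P2 ⟶ P1) (d1 : P1 ⟶ P0) (w : d2 ≫ d1 = 0) :
    ∀ n, kosd d2 d1 (n + 1) ≫ kosd d2 d1 n = 0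
  | 0 => w
  | _ + 1 => zero_comp

def kosC {P0 P1 P2 : C} (d2 : P2 ⟶ P1) (d1 : P1 ⟶ P0) (w : d2 ≫ d1 = 0) : ChainComplex C ℕ :=
  ChainComplex.of (kosX P0 P1 P2) (kosd d2 d1) (kosd_sq d2 d1 w)

lemma kosC_d {P0 P1 P2 : C} (d2 : P2 ⟶ P1) (d1 : P1 ⟶ P0) (w : d2 ≫ d1 = 0) (n : ℕ) :
    (kosC d2 d1 w).d (n + 1) n = kosd d2 d1 n :=
  ChainComplex.of_d _ _ _

lemma kosC_exact {P0 P1 P2 : C} (d2 : P2 ⟶ P1) (d1 : P1 ⟶ P0) (w : d2 ≫ d1 = 0)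
    [Mono d2] (h1 : (ShortComplex.mk d2 d1 w).Exact) (n : ℕ) :
    (kosC d2 d1 w).ExactAt (n + 1) := by
  rw [HomologicalComplex.exactAt_iff' _ (n + 1 + 1) (n + 1) n (by simp) (by simp)]
  match n with
  | 0 =>
    refine (ShortComplex.exact_iff_of_iso ?_).2 h1
    exact ShortComplex.isoMk (Iso.refl _) (Iso.refl _) (Iso.refl _)
      (by
        refine (Category.id_comp _).trans (Eq.trans ?_ (Category.comp_id _).symm)
        exact (kosC_d d2 d1 w 1).symm)
      (by
        refine (Category.id_comp _).trans (Eq.trans ?_ (Category.comp_id _).symm)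
        exact (kosC_d d2 d1 w 0).symm)
  | 1 =>
    have hm : Mono d2 := inferInstance
    have h : Mono ((kosC d2 d1 w).sc' 3 2 1).g := by
      have : ((kosC d2 d1 w).sc' 3 2 1).g = d2 := kosC_d d2 d1 w 1
      rw [this]
      exact hm
    refine (ShortComplex.exact_iff_mono _ ?_).2 h
    exact (isZero_zero C).eq_of_src _ _
  | n + 2 =>
    apply ShortComplex.exact_of_isZero_X₂
    exact isZero_zero C

def kosRes {P0 P1 P2 M : C} (d2 : P2 ⟶ P1) (d1 : P1 ⟶ P0) (ε : P0 ⟶ M) (w : d2 ≫ d1 = 0)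
    (w' : d1 ≫ ε = 0)
    [Projective P0] [Projective P1] [Projective P2]
    [Mono d2] [Epi ε] (h1 : (ShortComplex.mk d2 d1 w).Exact)
    (h0 : (ShortComplex.mk d1 ε w').Exact) : ProjectiveResolution M where
  complex := kosC d2 d1 w
  projective n := by
    match n with
    | 0 => exact ‹Projective P0›
    | 1 => exact ‹Projective P1›
    | 2 => exact ‹Projective P2›
    | n + 3 => exact (inferInstance : Projective (0 : C))
  π := (ChainComplex.toSingle₀Equiv (kosC d2 d1 w) M).symm ⟨ε, by
          rw [kosC_d]; exact w'⟩
  quasiIso := ⟨fun n => by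
    cases n
    · rw [ChainComplex.quasiIsoAt₀_iff, ShortComplex.quasiIso_iff_of_zeros' _ rfl rfl rfl]
      refine (ShortComplex.exact_and_epi_g_iff_of_iso ?_).2 ⟨h0, by assumption⟩
      exact ShortComplex.isoMk (Iso.refl _) (Iso.refl _) (Iso.refl _)
          (by 
            refine (Category.id_comp _).trans (Eq.trans ?_ (Category.comp_id _).symm)
            exact (kosC_d d2 d1 w 0).symm)
          (by 
            refine (Category.id_comp _).trans (Eq.trans ?_ (Category.comp_id _).symm)
            exact (ChainComplex.toSingle₀Equiv_symm_apply_f_zero (C := kosC d2 d1 w) ε _).symm)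
    · rw [quasiIsoAt_iff_exactAt']
      · exact kosC_exact d2 d1 w h1 _
      · apply ChainComplex.exactAt_succ_single_obj⟩

variable {k : Type v} [Field k] [Linear k C] [EnoughProjectives C]

lemma kos_ext {P0 P1 P2 M Y : C} (d2 : P2 ⟶ P1) (d1 : P1 ⟶ P0) (ε : P0 ⟶ M) (w : d2 ≫ d1 = 0)
    (w' : d1 ≫ ε = 0)
    [Projective P0] [Projective P1] [Projective P2]
    [Mono d2] [Epi ε] (h1 : (ShortComplex.mk d2 d1 w).Exact)
    (h0 : (ShortComplex.mk d1 ε w').Exact)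
    (H0 : ∀ f : P0 ⟶ Y, d1 ≫ f = 0 → f = 0)
    (H1 : ∀ f : P1 ⟶ Y, d2 ≫ f = 0 → ∃ c : P0 ⟶ Y, d1 ≫ c = f)
    (L : (P2 ⟶ Y) →ₗ[k] k) (hL : Function.Surjective L)
    (H2 : ∀ f : P2 ⟶ Y, L f = 0 ↔ ∃ c : P1 ⟶ Y, d2 ≫ c = f) :
    Subsingleton (((Ext k C 0).obj (Opposite.op M)).obj Y) ∧
    Subsingleton (((Ext k C 1).obj (Opposite.op M)).obj Y) ∧
    Module.finrank k (((Ext k C 2).obj (Opposite.op M)).obj Y) = 1 ∧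
    (∀ m : ℕ, 3 ≤ m → Subsingleton (((Ext k C m).obj (Opposite.op M)).obj Y)) := by
  have key : ∀ m, ((kosC d2 d1 w).linearYonedaObj k Y).ExactAt m →
      Subsingleton (((Ext k C m).obj (Opposite.op M)).obj Y) := by
    intro m hm
    apply ModuleCat.subsingleton_of_isZero
    rw [HomologicalComplex.exactAt_iff_isZero_homology] at hm
    exact IsZero.of_iso hm ((kosRes d2 d1 ε w w' h1 h0).isoExt m Y)
  refine ⟨key 0 ?_, key 1 ?_, ?_, fun m hm => key m ?_⟩
  · rw [HomologicalComplex.exactAt_iff' _ 0 0 1 (by simp) (by simp)]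
    rw [ShortComplex.moduleCat_exact_iff]
    intro (f : P0 ⟶ Y) hf
    refine ⟨0, ?_⟩
    rw [map_zero]
    refine (H0 f ?_).symm
    have := hf
    change (kosC d2 d1 w).d 1 0 ≫ f = 0 at this
    rwa [kosC_d] at this
  · rw [HomologicalComplex.exactAt_iff' _ 0 1 2 (by simp) (by simp)]
    rw [ShortComplex.moduleCat_exact_iff]
    intro (f : P1 ⟶ Y) hf
    have := hf
    change (kosC d2 d1 w).d 2 1 ≫ f = 0 at this
    rw [kosC_d] at this
    obtain ⟨c, hc⟩ := H1 f this
    refine ⟨c, ?_⟩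
    change (kosC d2 d1 w).d 1 0 ≫ c = f
    rw [kosC_d]
    exact hc
  · let S := ((kosC d2 d1 w).linearYonedaObj k Y).sc' 1 2 3
    let e : ((Ext k C 2).obj (Opposite.op M)).obj Y ≅ S.moduleCatLeftHomologyData.H :=
      (kosRes d2 d1 ε w w' h1 h0).isoExt 2 Y ≪≫
      ((kosC d2 d1 w).linearYonedaObj k Y).homologyIsoSc' 1 2 3 (by simp) (by simp) ≪≫
      S.moduleCatHomologyIso
    rw [e.toLinearEquiv.finrank_eq]
    let L' : LinearMap.ker S.g.hom →ₗ[k] k := LinearMap.comp (M₂ := (P2 ⟶ Y)) L (LinearMap.ker S.g.hom).subtype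
    have hg : ∀ f, S.g.hom f = 0 := by
      intro f
      exact (isZero_zero C).eq_of_src (X := (kosC d2 d1 w).X 3) (Y := Y) _ _
    have hL' : Function.Surjective L' := by
      intro c
      obtain ⟨f, hf⟩ := hL c
      exact ⟨⟨f, hg f⟩, hf⟩
    have hr : LinearMap.range S.moduleCatToCycles = LinearMap.ker L' := by
      ext ⟨f, hf⟩
      rw [LinearMap.mem_ker, LinearMap.mem_range]
      change _ ↔ L f = 0
      rw [H2 f]
      constructor
      · rintro ⟨c, hc⟩
        refine ⟨c, ?_⟩
        have := congrArg Subtype.val hc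
        change (kosC d2 d1 w).d 2 1 ≫ c = f at this
        rwa [kosC_d] at this
      · rintro ⟨c, hc⟩
        refine ⟨c, Subtype.ext ?_⟩
        change (kosC d2 d1 w).d 2 1 ≫ c = f 
        rw [kosC_d]
        exact hc
    have e2 : S.moduleCatLeftHomologyData.H ≃ₗ[k] k :=
      (Submodule.quotEquivOfEq _ _ hr).trans (L'.quotKerEquivOfSurjective hL')
    rw [e2.finrank_eq, Module.finrank_self]
  · obtain ⟨n, rfl⟩ := Nat.exists_eq_add_of_le' hm
    rw [HomologicalComplex.exactAt_iff]
    apply ShortComplex.exact_of_isZero_X₂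
    have : Subsingleton ((kosC d2 d1 w).X (n + 3) ⟶ Y) :=
      ⟨fun a b => (isZero_zero C).eq_of_src _ _⟩
    exact ModuleCat.isZero_of_subsingleton
      (ModuleCat.of k ((kosC d2 d1 w).X (n + 3) ⟶ Y))
end KosCat
section Alg

/-- recursive geometric sums -/
def gS {B : Type} [Ring B] (l r : B) : ℕ → B
  | 0 => 0
  | n + 1 => l ^ n + r * gS l r n

def gT {k B : Type} [Field k] [Ring B] [Algebra k B] (p : k) (l r : B) : ℕ → B
  | 0 => 0
  | n + 1 => p • (r * gT p l r n - l ^ n)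

lemma pow_swap {k B : Type} [Field k] [Ring B] [Algebra k B] (p : k) (x y : B)
    (h : y * x = p • (x * y)) (n : ℕ) : y ^ n * x = p ^ n • (x * y ^ n) := by
  induction n with
  | zero => simp
  | succ n ih =>
    rw [pow_succ' y, mul_assoc, ih, mul_smul_comm, ← mul_assoc, h, smul_mul_assoc, smul_smul,
      mul_assoc, pow_succ]

lemma gT_mul1 {k B : Type} [Field k] [Ring B] [Algebra k B] (Q p : k) (hQp : Q * p = 1)
    (l r : B) (h : l * r = r * l) (n : ℕ) :
    gT p l r n * (r - Q • l) = l ^ n - p ^ n • r ^ n := by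
  have hpQ : p * Q = 1 := by rw [mul_comm, hQp]
  have hc : ∀ n, l ^ n * r = r * l ^ n := fun n => (Commute.pow_left (show Commute l r from h) n)
  induction n with
  | zero => simp [gT]
  | succ n ih =>
    simp only [gT]
    rw [smul_mul_assoc, sub_mul, mul_assoc, ih, mul_sub, mul_sub, hc, mul_smul_comm, mul_smul_comm,
      ← pow_succ, ← pow_succ']
    simp only [smul_sub, smul_smul, hpQ, one_smul, pow_succ' p]
    abel

lemma gT_mul2 {k B : Type} [Field k] [Ring B] [Algebra k B] (Q p : k) (hQp : Q * p = 1)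
    (l1 l2 r1 r2 : B) (hl : l2 * l1 = p • (l1 * l2)) (hr : r2 * r1 = Q • (r1 * r2))
    (h12 : l1 * r2 = r2 * l1) (h21 : l2 * r1 = r1 * l2) (n : ℕ) :
    gT p l2 r2 n * (l1 - Q • r1) = r1 * gS l2 r2 n - p ^ n • (l1 * gS l2 r2 n) := by
  have hpQ : p * Q = 1 := by rw [mul_comm, hQp]
  have hc : ∀ n, l2 ^ n * r1 = r1 * l2 ^ n :=
    fun n => (Commute.pow_left (show Commute l2 r1 from h21) n)
  induction n with
  | zero => simp [gT, gS]
  | succ n ih =>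
    simp only [gT, gS]
    rw [smul_mul_assoc, sub_mul, mul_assoc, ih, mul_sub, mul_sub, mul_smul_comm, mul_smul_comm,
      pow_swap p l1 l2 hl, hc, ← mul_assoc, hr, ← mul_assoc, ← h12, mul_add, mul_add, 
      ← mul_assoc, ← mul_assoc]
    simp only [smul_sub, smul_smul, smul_add, smul_mul_assoc, hpQ, one_smul, pow_succ' p]
    abel

end Alg

section PBW
variable (k : Type) [Field k] (q : Fin 2 → Fin 2 → k)

abbrev PB := (ℕ × ℕ) →₀ k

def pT0 : PB k →ₗ[k] PB k := Finsupp.linearCombination k fun a => Finsupp.single (a.1 + 1, a.2) 1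
def pT1 (p : k) : PB k →ₗ[k] PB k :=
  Finsupp.linearCombination k fun a => Finsupp.single (a.1, a.2 + 1) (p ^ a.1)

@[simp] lemma pT0_single (a : ℕ × ℕ) (c : k) :
    pT0 k (Finsupp.single a c) = Finsupp.single (a.1 + 1, a.2) c := by
  simp [pT0]
@[simp] lemma pT1_single (p : k) (a : ℕ × ℕ) (c : k) :
    pT1 k p (Finsupp.single a c) = Finsupp.single (a.1, a.2 + 1) (c * p ^ a.1) := by
  simp [pT1]

lemma X_rel (i j : Fin 2) : (X k 2 q i) * (X k 2 q j) = q i j • ((X k 2 q j) * (X k 2 q i)) := by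
  simpa only [X, map_mul, map_smul] using
    RingQuot.mkAlgHom_rel k (QRel.rel (k := k) (N := 2) (q := q) i j)

variable (hq1 : ∀ i, q i i = 1) (hQ : q 0 1 * q 1 0 = 1)

def rho (hq1 : ∀ i, q i i = 1) (hQ : q 0 1 * q 1 0 = 1) : QSA k 2 q →ₐ[k] Module.End k (PB k) :=
  RingQuot.liftAlgHom k
    ⟨FreeAlgebra.lift k (![pT0 k, pT1 k (q 1 0)]), by
      intro x y h
      induction h with
      | rel i j =>
        have hQ' : q 1 0 * q 0 1 = 1 := by rw [mul_comm, hQ]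
        simp only [map_mul, map_smul, FreeAlgebra.lift_ι_apply]
        fin_cases i <;> fin_cases j
        · simp [hq1]
        · refine Finsupp.lhom_ext fun a b => ?_
          simp only [Fin.zero_eta, Fin.mk_one, Matrix.cons_val_zero, Matrix.cons_val_one,
            LinearMap.smul_apply, Module.End.mul_apply, pT0_single, pT1_single, Finsupp.smul_single,
            smul_eq_mul]
          congr 1
          rw [pow_succ]
          linear_combination (- b * (q 1 0) ^ a.1) * hQ
        · refine Finsupp.lhom_ext fun a b => ?_
          simp only [Fin.zero_eta, Fin.mk_one, Matrix.cons_val_zero, Matrix.cons_val_one,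
            LinearMap.smul_apply, Module.End.mul_apply, pT0_single, pT1_single, Finsupp.smul_single,
            smul_eq_mul]
          congr 1
          rw [pow_succ]
          ring
        · simp [hq1]⟩

lemma rho_X0 : rho k q hq1 hQ (X k 2 q 0) = pT0 k := by
  simp [rho, X]
lemma rho_X1 : rho k q hq1 hQ (X k 2 q 1) = pT1 k (q 1 0) := by
  simp [rho, X]

def phiL : QSA k 2 q →ₗ[k] PB k :=
  (LinearMap.applyₗ (Finsupp.single (0, 0) (1 : k))).comp (rho k q hq1 hQ).toLinearMap

def psiL : PB k →ₗ[k] QSA k 2 q :=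
  Finsupp.linearCombination k fun a => X k 2 q 0 ^ a.1 * X k 2 q 1 ^ a.2

lemma phiL_apply (a : QSA k 2 q) :
    phiL k q hq1 hQ a = rho k q hq1 hQ a (Finsupp.single (0, 0) (1 : k)) := rfl

lemma phiL_mul (a b : QSA k 2 q) :
    phiL k q hq1 hQ (a * b) = rho k q hq1 hQ a (phiL k q hq1 hQ b) := by
  simp [phiL_apply]

lemma phiL_X0_mul (b : QSA k 2 q) :
    phiL k q hq1 hQ (X k 2 q 0 * b) = pT0 k (phiL k q hq1 hQ b) := by
  rw [phiL_mul, rho_X0]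
lemma phiL_X1_mul (b : QSA k 2 q) :
    phiL k q hq1 hQ (X k 2 q 1 * b) = pT1 k (q 1 0) (phiL k q hq1 hQ b) := by
  rw [phiL_mul, rho_X1]

lemma phiL_mon (i j : ℕ) :
    phiL k q hq1 hQ (X k 2 q 0 ^ i * X k 2 q 1 ^ j) = Finsupp.single (i, j) 1 := by
  induction i with
  | zero =>
    induction j with
    | zero => simp [phiL_apply]
    | succ j ih =>
      rw [pow_zero, one_mul] at ih ⊢
      rw [pow_succ', phiL_X1_mul, ih]
      simp
  | succ i ih => rw [pow_succ', mul_assoc, phiL_X0_mul, ih]; simp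

lemma QSA_ind {P : QSA k 2 q → Prop} (h1 : ∀ c : k, P (algebraMap k _ c))
    (hX : ∀ i, P (X k 2 q i)) (hm : ∀ a b, P a → P b → P (a * b))
    (ha : ∀ a b, P a → P b → P (a + b)) (a) : P a := by
  obtain ⟨a, rfl⟩ := RingQuot.mkAlgHom_surjective k (QRel k 2 q) a
  induction a using FreeAlgebra.induction with
  | grade0 c => rw [AlgHom.commutes]; exact h1 c
  | grade1 i => exact hX i
  | mul a b ha hb => rw [map_mul]; exact hm _ _ ha hb
  | add a b h h' => rw [map_add]; exact ha _ _ h h'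

lemma psiL_single (i : ℕ × ℕ) (c : k) : psiL k q (Finsupp.single i c) =
    c • (X k 2 q 0 ^ i.1 * X k 2 q 1 ^ i.2) := by simp [psiL]

lemma psiL_rho (a : QSA k 2 q) : ∀ m, psiL k q (rho k q hq1 hQ a m) = a * psiL k q m := by
  induction a using QSA_ind with
  | h1 c => intro m; simp [Algebra.algebraMap_eq_smul_one]
  | hX i =>
    intro m
    induction m using Finsupp.induction_linear with
    | zero => simp
    | add f g hf hg => rw [map_add, map_add, map_add, mul_add, hf, hg]
    | single a c =>
      fin_cases i
      · simp only [Fin.zero_eta]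
        rw [rho_X0, pT0_single, psiL_single, psiL_single, mul_smul_comm, pow_succ', mul_assoc]
      · simp only [Fin.mk_one]
        rw [rho_X1, pT1_single, psiL_single, psiL_single, mul_smul_comm, ← mul_assoc]
        have := pow_swap (k := k) (q 0 1) (X k 2 q 1) (X k 2 q 0) (X_rel k q 0 1) a.1
        have h2 : X k 2 q 1 * X k 2 q 0 ^ a.1 = (q 1 0 ^ a.1) • (X k 2 q 0 ^ a.1 * X k 2 q 1) := by
          rw [this, smul_smul, ← mul_pow, mul_comm (q 1 0), hQ, one_pow, one_smul]
        rw [h2, smul_mul_assoc, smul_smul, mul_assoc, pow_succ']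
  | hm a b ha hb => intro m; rw [map_mul, Module.End.mul_apply, ha, hb, mul_assoc]
  | ha a b ha hb => intro m; rw [map_add, LinearMap.add_apply, map_add, ha, hb, add_mul]

def phiE : QSA k 2 q ≃ₗ[k] PB k :=
  LinearEquiv.ofLinearMap (phiL k q hq1 hQ) (psiL k q)
    (by
      refine Finsupp.lhom_ext fun a b => ?_
      rw [LinearMap.comp_apply, psiL_single, map_smul, phiL_mon]
      simp)
    (by
      ext a
      rw [LinearMap.comp_apply, phiL_apply, psiL_rho, psiL_single]
      simp)

lemma phiE_apply (a) : phiE k q hq1 hQ a = phiL k q hq1 hQ a := rfl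

lemma QSA_mon_ind (hq1 : ∀ i, q i i = 1) (hQ : q 0 1 * q 1 0 = 1) {P : QSA k 2 q → Prop} (h0 : P 0)
    (hm : ∀ (i j) (c : k), P (c • (X k 2 q 0 ^ i * X k 2 q 1 ^ j)))
    (ha : ∀ a b, P a → P b → P (a + b)) (a) : P a := by
  obtain ⟨a, rfl⟩ := (phiE k q hq1 hQ).symm.surjective a
  change P (psiL k q a)
  induction a using Finsupp.induction_linear with
  | zero => simpa using h0
  | add f g hf hg => rw [map_add]; exact ha _ _ hf hg
  | single a c => rw [psiL_single]; exact hm _ _ _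

end PBW
section AbsRes

structure KData (k : Type) [Field k] (q : Fin 2 → Fin 2 → k) (B C : Type) [Ring B] [Algebra k B]
    where
  eL : Fin 2 → B
  eR : Fin 2 → B
  iR : C → B
  cR : Fin 2 → C
  heR : ∀ i, eR i = iR (cR i)
  eLR : ∀ i j, eL i * eR j = eR j * eL i
  eL_rel : ∀ i j, eL i * eL j = q i j • (eL j * eL i)
  eR_rel : ∀ i j, eR i * eR j = q j i • (eR j * eR i)
  ind : ∀ P : B → Prop, (∀ i j, P (eL 0 ^ i * eL 1 ^ j)) → (∀ a b, P a → P b → P (a + b)) →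
    (∀ c b, P b → P (iR c * b)) → ∀ b, P b
  monExt : (ℕ × ℕ → B) → B →ₗ[k] B
  monExt_mon : ∀ F i j, monExt F (eL 0 ^ i * eL 1 ^ j) = F (i, j)
  monExt_iR : ∀ F c b, monExt F (iR c * b) = iR c * monExt F b
  hQ : q 0 1 * q 1 0 = 1

namespace KData
variable {k : Type} [Field k] {q : Fin 2 → Fin 2 → k} {B C : Type} [Ring B] [Algebra k B]
  (K : KData k q B C)

lemma monExt_eR (F : ℕ × ℕ → B) (i : Fin 2) (b : B) :
    K.monExt F (K.eR i * b) = K.eR i * K.monExt F b := by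
  rw [K.heR, K.monExt_iR]

def h1a := K.monExt fun a => K.eR 1 ^ a.2 * gS (K.eL 0) (K.eR 0) a.1
def h1b := K.monExt fun a => K.eL 0 ^ a.1 * gS (K.eL 1) (K.eR 1) a.2
def h2 := K.monExt fun a => K.eL 0 ^ a.1 * gT (q 1 0) (K.eL 1) (K.eR 1) a.2

lemma mon_swap0 (i j : ℕ) : K.eL 0 ^ i * K.eL 1 ^ j * K.eL 0 =
    (q 1 0 ^ j) • (K.eL 0 ^ (i + 1) * K.eL 1 ^ j) := by
  rw [mul_assoc, pow_swap (q 1 0) _ _ (K.eL_rel 1 0), mul_smul_comm, ← mul_assoc, pow_succ]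
lemma mon_swap1 (i j : ℕ) : K.eL 0 ^ i * K.eL 1 ^ j * K.eL 1 =
    K.eL 0 ^ i * K.eL 1 ^ (j + 1) := by
  rw [mul_assoc, pow_succ]

lemma eLpR (i j : Fin 2) (n : ℕ) : K.eL i ^ n * K.eR j = K.eR j * K.eL i ^ n :=
  Commute.pow_left (show Commute _ _ from K.eLR i j) n
lemma eLRp (i j : Fin 2) (n : ℕ) : K.eL i * K.eR j ^ n = K.eR j ^ n * K.eL i :=
  Commute.pow_right (show Commute _ _ from K.eLR i j) n
lemma eLpRp (i j : Fin 2) (m n : ℕ) :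
    K.eL i ^ m * K.eR j ^ n = K.eR j ^ n * K.eL i ^ m :=
  Commute.pow_pow (show Commute _ _ from K.eLR i j) m n
lemma mon_swapR (i j : ℕ) (s : Fin 2) : K.eL 0 ^ i * K.eL 1 ^ j * K.eR s =
    K.eR s * (K.eL 0 ^ i * K.eL 1 ^ j) := by
  rw [mul_assoc, K.eLpR, ← mul_assoc, K.eLpR, mul_assoc]

lemma E1a (b : B) :
    K.h2 b * (K.eR 1 - q 0 1 • K.eL 1) + K.h1a (b * (K.eL 0 - K.eR 0))
      = b := by
  revert b
  refine K.ind _ (fun i j => ?_) (fun a b h h' => ?_) (fun c b h => ?_)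
  rotate_left
  ·
    rw [map_add, add_mul, add_mul, map_add, add_add_add_comm, h, h']
  ·
    rw [KData.h2, KData.h1a, mul_assoc, K.monExt_iR, K.monExt_iR, mul_assoc, ← mul_add]
    rw [KData.h2, KData.h1a] at h
    rw [h]
  ·
    rw [KData.h2, KData.h1a, mul_sub (_ * _), K.mon_swap0, K.mon_swapR, map_sub, map_smul, K.monExt_mon]
    rw [K.monExt_eR, K.monExt_mon, K.monExt_mon, mul_assoc, gT_mul1 _ _ K.hQ _ _ (K.eLR 1 1)]
    have hs : K.eR 0 * K.eR 1 ^ j = q 1 0 ^ j • (K.eR 1 ^ j * K.eR 0) := by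
      rw [pow_swap (q 0 1) _ _ (K.eR_rel 1 0), smul_smul, ← mul_pow, mul_comm, K.hQ, one_pow,
        one_smul]
    rw [← mul_assoc, hs, smul_mul_assoc, ← smul_sub, mul_assoc, ← mul_sub]
    simp only [gS]
    rw [add_sub_cancel_right, mul_sub, mul_smul_comm, K.eLpRp]
    abel

lemma E1b (b : B) :
    K.h2 b * (K.eL 0 - q 0 1 • K.eR 0) + K.h1b (b * (K.eL 0 - K.eR 0))
      = 0 := by
  revert b
  refine K.ind _ (fun i j => ?_) (fun a b h h' => ?_) (fun c b h => ?_)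
  rotate_left
  ·
    rw [map_add, add_mul, add_mul, map_add, add_add_add_comm, h, h', add_zero]
  ·
    rw [KData.h2, KData.h1b, mul_assoc, K.monExt_iR, K.monExt_iR, mul_assoc, ← mul_add]
    rw [KData.h2, KData.h1b] at h
    rw [h, mul_zero]
  ·
    rw [KData.h2, KData.h1b, mul_sub (_ * _), K.mon_swap0, K.mon_swapR, map_sub, map_smul, K.monExt_mon]
    rw [K.monExt_eR, K.monExt_mon, K.monExt_mon, mul_assoc,
      gT_mul2 _ _ K.hQ _ _ _ _ (K.eL_rel 1 0) (K.eR_rel 1 0) (K.eLR 0 1) (K.eLR 1 0)]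
    rw [mul_sub, mul_smul_comm, ← mul_assoc, ← mul_assoc, ← mul_assoc, ← pow_succ, K.eLpR]
    abel

lemma E2a (b : B) : K.h1a (b * (K.eL 1 - K.eR 1)) = 0 := by
  revert b
  refine K.ind _ (fun i j => ?_) (fun a b h h' => ?_) (fun c b h => ?_)
  rotate_left
  ·
    rw [add_mul, map_add, h, h', add_zero]
  ·
    rw [KData.h1a, mul_assoc, K.monExt_iR]
    rw [KData.h1a] at h
    rw [h, mul_zero]
  ·
    rw [KData.h1a, mul_sub (_ * _), K.mon_swap1, K.mon_swapR, map_sub, K.monExt_mon]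
    rw [K.monExt_eR, K.monExt_mon]
    simp only
    rw [pow_succ', mul_assoc, sub_self]

lemma E2b (b : B) : K.h1b (b * (K.eL 1 - K.eR 1)) = b := by
  revert b
  refine K.ind _ (fun i j => ?_) (fun a b h h' => ?_) (fun c b h => ?_)
  rotate_left
  ·
    rw [add_mul, map_add, h, h']
  ·
    rw [KData.h1b, mul_assoc, K.monExt_iR]
    rw [KData.h1b] at h
    rw [h]
  ·
    rw [KData.h1b, mul_sub (_ * _), K.mon_swap1, K.mon_swapR, map_sub, K.monExt_mon]
    rw [K.monExt_eR, K.monExt_mon]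
    simp only [gS]
    rw [← mul_assoc (K.eR 1), ← K.eLpR, mul_add, mul_assoc, add_sub_cancel_right]

lemma E3 (b : B) : K.h2 (b * (K.eR 1 - q 0 1 • K.eL 1)) = b := by
  revert b
  refine K.ind _ (fun i j => ?_) (fun a b h h' => ?_) (fun c b h => ?_)
  rotate_left
  ·
    rw [add_mul, map_add, h, h']
  ·
    rw [KData.h2, mul_assoc, K.monExt_iR]
    rw [KData.h2] at h
    rw [h]
  ·
    rw [KData.h2, mul_sub (_ * _), mul_smul_comm, K.mon_swap1, K.mon_swapR, map_sub, map_smul, K.monExt_mon]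
    rw [K.monExt_eR, K.monExt_mon]
    simp only [gT]
    rw [mul_smul_comm, smul_smul, K.hQ, one_smul, ← mul_assoc (K.eR 1), ← K.eLpR, mul_sub, mul_assoc]
    abel

lemma d_sq :
    (K.eR 1 - q 0 1 • K.eL 1) * (K.eL 0 - K.eR 0) +
    (K.eL 0 - q 0 1 • K.eR 0) * (K.eL 1 - K.eR 1) = 0 := by
  simp only [sub_mul, mul_sub, smul_mul_assoc]
  rw [K.eL_rel 0 1, K.eR_rel 1 0, K.eLR, K.eLR]
  abel


def D2 : B →ₗ[B] B × B :=
  LinearMap.toSpanSingleton _ _ (K.eR 1 - q 0 1 • K.eL 1, K.eL 0 - q 0 1 • K.eR 0)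
def D1 : B × B →ₗ[B] B :=
  LinearMap.coprod (LinearMap.toSpanSingleton _ _ (K.eL 0 - K.eR 0))
    (LinearMap.toSpanSingleton _ _ (K.eL 1 - K.eR 1))

lemma D2_apply (b) : K.D2 b = (b * (K.eR 1 - q 0 1 • K.eL 1),
   b * (K.eL 0 - q 0 1 • K.eR 0)) := rfl
lemma D1_apply (b) : K.D1 b = b.1 * (K.eL 0 - K.eR 0) + b.2 * (K.eL 1 - K.eR 1) := rfl

lemma D2_inj : Function.Injective K.D2 := by
  intro a b hab
  rw [D2_apply, D2_apply] at hab
  have := (Prod.ext_iff.1 hab).1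
  simp only at this
  rw [← K.E3 a, this, K.E3]

lemma D1_D2 (b) : K.D1 (K.D2 b) = 0 := by
  rw [D2_apply, D1_apply, mul_assoc, mul_assoc, ← mul_add, K.d_sq, mul_zero]

lemma D1_exact (b) (hb : K.D1 b = 0) :
    ∃ c, K.D2 c = b := by
  refine ⟨K.h2 b.1, ?_⟩
  rw [D1_apply] at hb
  rw [D2_apply]
  refine Prod.ext ?_ ?_
  · have h := K.E1a b.1
    rw [eq_neg_of_add_eq_zero_left hb, map_neg, K.E2a, neg_zero, add_zero] at h
    exact h
  · have h := K.E1b b.1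
    rw [eq_neg_of_add_eq_zero_left hb, map_neg, K.E2b] at h
    exact eq_of_sub_eq_zero (by rw [sub_eq_add_neg]; exact h)

lemma De_exact {A : Type} [Ring A] [Algebra k A] (x : Fin 2 → A) (jL : A →ₐ[k] B)
    (jR : Aᵐᵒᵖ →ₐ[k] B) (hcomm : ∀ a b, jL a * jR b = jR b * jL a)
    (hL : ∀ i, jL (x i) = K.eL i) (hR : ∀ i, jR (MulOpposite.op (x i)) = K.eR i)
    (hA : ∀ P : A → Prop, (∀ c : k, P (algebraMap k _ c)) →
      (∀ i, P (x i)) → (∀ a b, P a → P b → P (a * b)) →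
      (∀ a b, P a → P b → P (a + b)) → ∀ a, P a)
    (hB : ∀ P : B → Prop, P 0 → (∀ a c, P (jR c * jL a)) → (∀ a b, P a → P b → P (a + b)) →
      ∀ b, P b)
    (De : B →+ A) (hDe : ∀ a c, De (jR c * jL a) = a * MulOpposite.unop c)
    (b) (hb : De b = 0) : ∃ c, K.D1 c = b := by
  have gen_mem : ∀ a, jL a - jR (MulOpposite.op a) ∈ LinearMap.range K.D1 := by
    refine hA _ (fun c => ?_) (fun i => ?_) (fun a b ha hb => ?_) (fun a b ha hb => ?_)
    · have : MulOpposite.op (algebraMap k A c) = algebraMap k _ c := rfl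
      rw [this, AlgHom.commutes, AlgHom.commutes, sub_self]
      exact zero_mem _
    · rw [hL, hR]
      fin_cases i
      · exact ⟨(1, 0), by rw [D1_apply]; simp⟩
      · exact ⟨(0, 1), by rw [D1_apply]; simp⟩
    · have := add_mem (Submodule.smul_mem _ (jL a) hb)
        (Submodule.smul_mem _ (jR (MulOpposite.op b)) ha)
      convert this using 1
      rw [smul_eq_mul, smul_eq_mul, mul_sub, mul_sub, MulOpposite.op_mul, map_mul, map_mul, hcomm]
      abel
    · have := add_mem ha hb
      convert this using 1
      rw [MulOpposite.op_add, map_add, map_add]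
      abel
  have key : ∀ b, b - jR (MulOpposite.op (De b)) ∈ LinearMap.range K.D1 := by
    refine hB _ ?_ (fun a c => ?_) (fun a b h h' => ?_)
    · simp
    · have := Submodule.smul_mem _ (jR c) (gen_mem a)
      convert this using 1
      rw [hDe, smul_eq_mul, mul_sub, MulOpposite.op_mul, map_mul, MulOpposite.op_unop]
    · have := add_mem h h'
      convert this using 1
      rw [map_add, MulOpposite.op_add, map_add]
      abel
  have := key b
  rw [hb] at this
  simpa using this

end KData
end AbsRes

section Res
variable (k : Type) [Field k] (q : Fin 2 → Fin 2 → k)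

def iL : QSA k 2 q →ₐ[k] QSAe k 2 q := Algebra.TensorProduct.includeLeft
def iR : (QSA k 2 q)ᵐᵒᵖ →ₐ[k] QSAe k 2 q := Algebra.TensorProduct.includeRight

lemma iL_iR (a : QSA k 2 q) (b : (QSA k 2 q)ᵐᵒᵖ) : iL k q a * iR k q b = a ⊗ₜ b := by
  simp [iL, iR]
lemma iR_iL (a : QSA k 2 q) (b : (QSA k 2 q)ᵐᵒᵖ) : iR k q b * iL k q a = a ⊗ₜ b := by
  simp [iL, iR]

lemma iLR_comm (a : QSA k 2 q) (b : (QSA k 2 q)ᵐᵒᵖ) :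
    iL k q a * iR k q b = iR k q b * iL k q a := by
  rw [iL_iR, iR_iL]

def eL (i : Fin 2) : QSAe k 2 q := iL k q (X k 2 q i)
def eR (i : Fin 2) : QSAe k 2 q := iR k q (MulOpposite.op (X k 2 q i))

lemma eLR (i j : Fin 2) : eL k q i * eR k q j = eR k q j * eL k q i := iLR_comm k q _ _

lemma eL_rel (i j : Fin 2) : eL k q i * eL k q j = q i j • (eL k q j * eL k q i) := by
  rw [eL, eL, ← map_mul, X_rel, map_smul, map_mul]

lemma eR_rel (i j : Fin 2) : eR k q i * eR k q j = q j i • (eR k q j * eR k q i) := by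
  rw [eR, eR, ← map_mul, ← MulOpposite.op_mul, X_rel, MulOpposite.op_smul, map_smul,
    MulOpposite.op_mul, map_mul]

lemma QSAe_ind (hq1 : ∀ i, q i i = 1) (hQ : q 0 1 * q 1 0 = 1) {P : QSAe k 2 q → Prop}
    (hm : ∀ i j, P (eL k q 0 ^ i * eL k q 1 ^ j))
    (ha : ∀ a b, P a → P b → P (a + b))
    (hr : ∀ c b, P b → P (iR k q c * b)) (b) : P b := by
  have h0 : P 0 := by simpa using hr 0 _ (hm 0 0)
  induction b using TensorProduct.induction_on with
  | zero => exact h0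
  | add a b h h' => exact ha _ _ h h'
  | tmul a b =>
    rw [← iR_iL]
    apply hr
    induction a using QSA_mon_ind k q hq1 hQ with
    | h0 => simpa using h0
    | hm i j c =>
      have := hr (algebraMap k _ c) _ (hm i j)
      rw [AlgHom.commutes, ← Algebra.smul_def] at this
      simpa [eL] using this
    | ha a b h h' => rw [map_add]; exact ha _ _ h h'

/-- right-linear extension -/
def rext (h : QSA k 2 q →ₗ[k] QSAe k 2 q) : QSAe k 2 q →ₗ[k] QSAe k 2 q :=
  TensorProduct.lift
    ((LinearMap.mul k (QSAe k 2 q)).flip.compl₁₂ h (iR k q).toLinearMap)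

lemma rext_tmul (h : QSA k 2 q →ₗ[k] QSAe k 2 q) (a b) :
    rext k q h (a ⊗ₜ b) = iR k q b * h a := by
  simp [rext]

lemma rext_iR (h : QSA k 2 q →ₗ[k] QSAe k 2 q) (c b) :
    rext k q h (iR k q c * b) = iR k q c * rext k q h b := by
  induction b using TensorProduct.induction_on with
  | zero => simp
  | add a b h h' => rw [mul_add, map_add, map_add, mul_add, h, h']
  | tmul a b =>
    rw [← iR_iL, ← mul_assoc, ← map_mul, iR_iL, iR_iL, rext_tmul, rext_tmul, map_mul, mul_assoc]

lemma rext_iL (h : QSA k 2 q →ₗ[k] QSAe k 2 q) (a) :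
    rext k q h (iL k q a) = h a := by
  have := rext_tmul k q h a 1
  rw [← iR_iL] at this
  simpa using this

def monExt (hq1 : ∀ i, q i i = 1) (hQ : q 0 1 * q 1 0 = 1) (F : ℕ × ℕ → QSAe k 2 q) :
    QSAe k 2 q →ₗ[k] QSAe k 2 q :=
  rext k q ((Finsupp.linearCombination k F).comp (phiE k q hq1 hQ).toLinearMap)

lemma monExt_mon (hq1 : ∀ i, q i i = 1) (hQ : q 0 1 * q 1 0 = 1) (F : ℕ × ℕ → QSAe k 2 q) (i j) :
    monExt k q hq1 hQ F (eL k q 0 ^ i * eL k q 1 ^ j) = F (i, j) := by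
  have : eL k q 0 ^ i * eL k q 1 ^ j = iL k q (X k 2 q 0 ^ i * X k 2 q 1 ^ j) := by
    simp [eL]
  rw [this, monExt, rext_iL]
  simp [phiE_apply, phiL_mon]

lemma monExt_iR (hq1 : ∀ i, q i i = 1) (hQ : q 0 1 * q 1 0 = 1) (F : ℕ × ℕ → QSAe k 2 q) (c b) :
    monExt k q hq1 hQ F (iR k q c * b) = iR k q c * monExt k q hq1 hQ F b := rext_iR k q _ _ _


def KD (hq1 : ∀ i, q i i = 1) (hQ : q 0 1 * q 1 0 = 1) :
    KData k q (QSAe k 2 q) (QSA k 2 q)ᵐᵒᵖ where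
  eL := eL k q
  eR := eR k q
  iR := iR k q
  cR i := MulOpposite.op (X k 2 q i)
  heR _ := rfl
  eLR := eLR k q
  eL_rel := eL_rel k q
  eR_rel := eR_rel k q
  ind _ h1 h2 h3 := QSAe_ind k q hq1 hQ h1 h2 h3
  monExt := monExt k q hq1 hQ
  monExt_mon := monExt_mon k q hq1 hQ
  monExt_iR := monExt_iR k q hq1 hQ
  hQ := hQ

def De : QSAe k 2 q →ₗ[QSAe k 2 q] QSA k 2 q := LinearMap.toSpanSingleton _ _ 1

lemma De_tmul (a c) : De k q (a ⊗ₜ c) = a * c.unop := by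
  change (a ⊗ₜ[k] c) • (1 : QSA k 2 q) = _
  rw [TensorProduct.Algebra.smul_def]
  simp

lemma De_surj : Function.Surjective (De k q) := fun a => ⟨a ⊗ₜ 1, by simp [De_tmul]⟩

lemma De_exact (hq1 : ∀ i, q i i = 1) (hQ : q 0 1 * q 1 0 = 1) (b) (hb : De k q b = 0) :
    ∃ c, (KD k q hq1 hQ).D1 c = b := by
  refine (KD k q hq1 hQ).De_exact (X k 2 q) (iL k q) (iR k q) (iLR_comm k q) (fun _ => rfl)
    (fun _ => rfl) (fun P h1 h2 h3 h4 => QSA_ind k q h1 h2 h3 h4) ?_ (De k q).toAddMonoidHom ?_ b hb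
  · intro P h0 h1 h2 b
    induction b using TensorProduct.induction_on with
    | zero => exact h0
    | add a b h h' => exact h2 _ _ h h'
    | tmul a c => rw [← iR_iL]; exact h1 _ _
  · intro a c
    rw [iR_iL]
    exact De_tmul k q a c

lemma De_eLR (i : Fin 2) : De k q (eL k q i - eR k q i) = 0 := by
  rw [map_sub, eL, eR]
  have h1 := iL_iR k q (X k 2 q i) 1
  have h2 := iL_iR k q 1 (MulOpposite.op (X k 2 q i))
  rw [map_one, mul_one] at h1
  rw [map_one, one_mul] at h2
  rw [h1, h2, De_tmul, De_tmul]
  simp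

lemma De_D1 (hq1 : ∀ i, q i i = 1) (hQ : q 0 1 * q 1 0 = 1) (b) :
    De k q ((KD k q hq1 hQ).D1 b) = 0 := by
  have h := fun b => (De k q).map_smul b
  have h0 := De_eLR k q 0
  have h1 := De_eLR k q 1
  rw [KData.D1_apply]
  refine ((De k q).map_add _ _).trans ?_
  refine (congrArg₂ (· + ·) ((h b.1 _).trans (congrArg _ h0))
    ((h b.2 _).trans (congrArg _ h1))).trans ?_
  simp

end Res
section Coh
variable (k : Type) [Field k] 

lemma pT0_apply_succ (u : PB k) (i j : ℕ) : pT0 k u (i + 1, j) = u (i, j) := by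
  induction u using Finsupp.induction_linear with
  | zero => simp
  | add f g hf hg => rw [map_add, Finsupp.add_apply, Finsupp.add_apply, hf, hg]
  | single a c => simp [Finsupp.single_apply, Prod.ext_iff]

lemma pT0_apply_zero (u : PB k) (j : ℕ) : pT0 k u (0, j) = 0 := by
  induction u using Finsupp.induction_linear with
  | zero => simp
  | add f g hf hg => rw [map_add, Finsupp.add_apply, hf, hg, add_zero]
  | single a c => simp [Finsupp.single_apply, Prod.ext_iff]

lemma pT1_apply_succ (p : k) (u : PB k) (i j : ℕ) : pT1 k p u (i, j + 1) = p ^ i * u (i, j) := by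
  induction u using Finsupp.induction_linear with
  | zero => simp
  | add f g hf hg => rw [map_add, Finsupp.add_apply, Finsupp.add_apply, hf, hg, mul_add]
  | single a c =>
    simp only [pT1_single, Finsupp.single_apply, Prod.ext_iff, Nat.add_right_cancel_iff]
    split_ifs with h
    · rw [h.1, mul_comm]
    · simp

lemma pT1_apply_zero (p : k) (u : PB k) (i : ℕ) : pT1 k p u (i, 0) = 0 := by
  induction u using Finsupp.induction_linear with
  | zero => simp
  | add f g hf hg => rw [map_add, Finsupp.add_apply, hf, hg, add_zero]
  | single a c => simp [Finsupp.single_apply, Prod.ext_iff]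

variable (q : Fin 2 → Fin 2 → k) (hq1 : ∀ i, q i i = 1) (hQ : q 0 1 * q 1 0 = 1)

lemma phi_mul_X0_succ (b : QSA k 2 q) (i j : ℕ) :
    phiE k q hq1 hQ (b * X k 2 q 0) (i + 1, j) = q 1 0 ^ j * phiE k q hq1 hQ b (i, j) := by
  induction b using QSA_mon_ind k q hq1 hQ with
  | h0 => simp
  | ha a b h h' => rw [add_mul, map_add, map_add, Finsupp.add_apply, Finsupp.add_apply, h, h',
      mul_add]
  | hm a b c =>
    rw [smul_mul_assoc, mul_assoc, pow_swap (q 1 0) _ _ (X_rel k q 1 0), mul_smul_comm,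
      ← mul_assoc, ← pow_succ, smul_smul, map_smul, map_smul, phiE_apply, phiE_apply, phiL_mon,
      phiL_mon]
    simp only [Finsupp.smul_single, Finsupp.single_apply, Prod.ext_iff, Nat.add_right_cancel_iff]
    split_ifs with h
    · rw [← h.2]; simp [mul_comm]
    · simp

lemma phi_mul_X0_zero (b : QSA k 2 q) (j : ℕ) :
    phiE k q hq1 hQ (b * X k 2 q 0) (0, j) = 0 := by
  induction b using QSA_mon_ind k q hq1 hQ with
  | h0 => simp
  | ha a b h h' => rw [add_mul, map_add, Finsupp.add_apply, h, h', add_zero]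
  | hm a b c =>
    rw [smul_mul_assoc, mul_assoc, pow_swap (q 1 0) _ _ (X_rel k q 1 0), mul_smul_comm,
      ← mul_assoc, ← pow_succ, smul_smul, map_smul, phiE_apply, phiL_mon]
    simp [Finsupp.single_apply, Prod.ext_iff]

lemma phi_mul_X1_succ (b : QSA k 2 q) (i j : ℕ) :
    phiE k q hq1 hQ (b * X k 2 q 1) (i, j + 1) = phiE k q hq1 hQ b (i, j) := by
  induction b using QSA_mon_ind k q hq1 hQ with
  | h0 => simp
  | ha a b h h' => rw [add_mul, map_add, map_add, Finsupp.add_apply, Finsupp.add_apply, h, h']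
  | hm a b c =>
    rw [smul_mul_assoc, mul_assoc, ← pow_succ, map_smul, map_smul, phiE_apply, phiE_apply, phiL_mon,
      phiL_mon]
    simp [Finsupp.single_apply, Prod.ext_iff]

lemma phi_mul_X1_zero (b : QSA k 2 q) (i : ℕ) :
    phiE k q hq1 hQ (b * X k 2 q 1) (i, 0) = 0 := by
  induction b using QSA_mon_ind k q hq1 hQ with
  | h0 => simp
  | ha a b h h' => rw [add_mul, map_add, Finsupp.add_apply, h, h', add_zero]
  | hm a b c =>
    rw [smul_mul_assoc, mul_assoc, ← pow_succ, map_smul, phiE_apply, phiL_mon]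
    simp [Finsupp.single_apply, Prod.ext_iff]

/-- Finsupp-level description: the four operators through their coefficients. -/
structure Ops (V : Type) [AddCommGroup V] (φ : V ≃+ PB k) (Q p l0 l1 : k) where
  D1 : V → V
  D2 : V → V
  E1 : V → V
  E2 : V → V
  D1s : ∀ c i j, φ (D1 c) (i + 1, j) = (1 - l0 * p ^ j) * φ c (i, j)
  D1z : ∀ c j, φ (D1 c) (0, j) = 0
  D2s : ∀ c i j, φ (D2 c) (i, j + 1) = (p ^ i - l1) * φ c (i, j)
  D2z : ∀ c i, φ (D2 c) (i, 0) = 0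
  E1s : ∀ c i j, φ (E1 c) (i, j + 1) = (l1 - Q * p ^ i) * φ c (i, j)
  E1z : ∀ c i, φ (E1 c) (i, 0) = 0
  E2s : ∀ c i j, φ (E2 c) (i + 1, j) = (1 - Q * (l0 * p ^ j)) * φ c (i, j)
  E2z : ∀ c j, φ (E2 c) (0, j) = 0

lemma mkFin (s : ℕ × ℕ → k) (T : Finset (ℕ × ℕ)) (f : ℕ × ℕ → ℕ × ℕ) (hf : f.Injective)
    (h : ∀ a, f a ∉ T → s a = 0) : ∃ u : PB k, ∀ a, u a = s a := by
  have hfin : (Function.support s).Finite := by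
    refine Set.Finite.subset (Set.Finite.preimage (hf.injOn) T.finite_toSet) ?_
    intro a ha
    by_contra hc
    exact ha (h a hc)
  exact ⟨Finsupp.ofSupportFinite s hfin, fun a => rfl⟩

namespace Ops
variable {k}
variable {V : Type} [AddCommGroup V] {φ : V ≃+ PB k} {Q p l0 l1 : k} (O : Ops k V φ Q p l0 l1)

lemma H0 (hA : ∀ i j, 1 - l0 * p ^ j ≠ 0 ∨ p ^ i - l1 ≠ 0) (c : V) (h1 : O.D1 c = 0)
    (h2 : O.D2 c = 0) : c = 0 := by
  apply φ.injective
  rw [map_zero]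
  ext ⟨i, j⟩
  have e1 := O.D1s c i j
  have e2 := O.D2s c i j
  rw [h1, map_zero, Finsupp.zero_apply] at e1
  rw [h2, map_zero, Finsupp.zero_apply] at e2
  rcases hA i j with h | h
  · exact (mul_eq_zero.1 e1.symm).resolve_left h
  · exact (mul_eq_zero.1 e2.symm).resolve_left h

lemma H1 (hQp : Q * p = 1) (hA : ∀ i j, 1 - l0 * p ^ j ≠ 0 ∨ p ^ i - l1 ≠ 0)
    (hB : l1 ≠ Q) (hC : Q * l0 ≠ 1) (c1 c2 : V) (h : O.E1 c1 + O.E2 c2 = 0) :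
    ∃ c, O.D1 c = c1 ∧ O.D2 c = c2 := by
  have hc : ∀ a, φ (O.E1 c1) a + φ (O.E2 c2) a = 0 := by
    intro a
    rw [← Finsupp.add_apply, ← map_add, h, map_zero, Finsupp.zero_apply]
  have z1 : ∀ j, φ c1 (0, j) = 0 := by
    intro j
    have := hc (0, j + 1)
    rw [O.E1s, O.E2z, add_zero, pow_zero, mul_one] at this
    exact (mul_eq_zero.1 this).resolve_left (sub_ne_zero.2 hB)
  have z2 : ∀ i, φ c2 (i, 0) = 0 := by
    intro i
    have := hc (i + 1, 0)
    rw [O.E1z, O.E2s, zero_add, pow_zero, mul_one] at this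
    exact (mul_eq_zero.1 this).resolve_left (sub_ne_zero.2 hC.symm)
  have z3 : ∀ i j, (p ^ i - l1) * φ c1 (i + 1, j) = (1 - l0 * p ^ j) * φ c2 (i, j + 1) := by
    intro i j
    have := hc (i + 1, j + 1)
    rw [O.E1s, O.E2s] at this
    have e1 : Q * p ^ (i + 1) = p ^ i := by rw [pow_succ', ← mul_assoc, hQp, one_mul]
    have e2 : Q * (l0 * p ^ (j + 1)) = l0 * p ^ j := by
      rw [pow_succ']; linear_combination l0 * p ^ j * hQp
    rw [e1, e2] at this
    linear_combination -this
  obtain ⟨u1, hu1⟩ := mkFin k (fun a => if 1 - l0 * p ^ a.2 ≠ 0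
      then φ c1 (a.1 + 1, a.2) / (1 - l0 * p ^ a.2) else 0) (φ c1).support
      (fun a => (a.1 + 1, a.2)) (by rintro ⟨a, b⟩ ⟨c, d⟩; simp)
      (by intro a ha; rw [Finsupp.notMem_support_iff.1 ha]; simp)
  obtain ⟨u2, hu2⟩ := mkFin k (fun a => if 1 - l0 * p ^ a.2 ≠ 0
      then 0 else φ c2 (a.1, a.2 + 1) / (p ^ a.1 - l1)) (φ c2).support
      (fun a => (a.1, a.2 + 1)) (by rintro ⟨a, b⟩ ⟨c, d⟩; simp)
      (by intro a ha; rw [Finsupp.notMem_support_iff.1 ha]; simp)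
  have hu : ∀ i j, (1 - l0 * p ^ j) * (u1 + u2) (i, j) = φ c1 (i + 1, j) ∧
      (p ^ i - l1) * (u1 + u2) (i, j) = φ c2 (i, j + 1) := by
    intro i j
    rw [Finsupp.add_apply, hu1, hu2]
    have hz := z3 i j
    by_cases hx : 1 - l0 * p ^ j = 0
    · have hy := (hA i j).resolve_left (fun h => h hx)
      simp only [hx, ne_eq, not_true_eq_false, if_false, zero_add, zero_mul] at hz ⊢
      refine ⟨((mul_eq_zero.1 hz).resolve_left hy).symm, ?_⟩
      field_simp
    · simp only [ne_eq, hx, not_false_eq_true, if_true, add_zero]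
      constructor
      · field_simp
      · rw [← mul_div_assoc, hz, mul_div_assoc, mul_div_cancel₀ _ hx]
  refine ⟨φ.symm (u1 + u2), ?_, ?_⟩
  · apply φ.injective
    ext ⟨i, j⟩
    cases i with
    | zero => rw [O.D1z, z1]
    | succ i => rw [O.D1s, AddEquiv.apply_symm_apply, (hu i j).1]
  · apply φ.injective
    ext ⟨i, j⟩
    cases j with
    | zero => rw [O.D2z, z2]
    | succ j => rw [O.D2s, AddEquiv.apply_symm_apply, (hu i j).2]

lemma H2 (hQp : Q * p = 1) (hA : ∀ i j, 1 - l0 * p ^ j ≠ 0 ∨ p ^ i - l1 ≠ 0)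
    (hB : l1 ≠ Q) (hC : Q * l0 ≠ 1) (c : V) :
    φ c (0, 0) = 0 ↔ ∃ c1 c2, O.E1 c1 + O.E2 c2 = c := by
  constructor
  · intro h0
    obtain ⟨u1, hu1⟩ := mkFin k (fun a => if l1 - Q * p ^ a.1 ≠ 0
      then φ c (a.1, a.2 + 1) / (l1 - Q * p ^ a.1) else 0) (φ c).support
      (fun a => (a.1, a.2 + 1)) (by rintro ⟨a, b⟩ ⟨c, d⟩; simp)
      (by intro a ha; rw [Finsupp.notMem_support_iff.1 ha]; simp)
    obtain ⟨u2, hu2⟩ := mkFin k (fun a => if a.2 ≠ 0 ∧ l1 - Q * p ^ (a.1 + 1) ≠ 0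
      then 0 else φ c (a.1 + 1, a.2) / (1 - Q * (l0 * p ^ a.2))) (φ c).support
      (fun a => (a.1 + 1, a.2)) (by rintro ⟨a, b⟩ ⟨c, d⟩; simp)
      (by intro a ha; rw [Finsupp.notMem_support_iff.1 ha]; simp)
    refine ⟨φ.symm u1, φ.symm u2, ?_⟩
    apply φ.injective
    rw [map_add]
    ext ⟨i, j⟩
    rw [Finsupp.add_apply]
    cases i with
    | zero =>
      rw [O.E2z, add_zero]
      cases j with
      | zero => rw [O.E1z, h0]
      | succ j =>
        rw [O.E1s, AddEquiv.apply_symm_apply, hu1]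
        have : l1 - Q * p ^ 0 ≠ 0 := by rw [pow_zero, mul_one]; exact sub_ne_zero.2 hB
        simp only [ne_eq, this, not_false_eq_true, if_true]
        field_simp
    | succ i =>
      rw [O.E2s, AddEquiv.apply_symm_apply, hu2]
      cases j with
      | zero =>
        rw [O.E1z]
        have : 1 - Q * (l0 * p ^ 0) ≠ 0 := by rw [pow_zero, mul_one]; exact sub_ne_zero.2 hC.symm
        simp only [ne_eq, not_true_eq_false, false_and, if_false, zero_add]
        field_simp
      | succ j =>
        rw [O.E1s, AddEquiv.apply_symm_apply, hu1]
        by_cases hx : l1 - Q * p ^ (i + 1) = 0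
        · have e1 : Q * p ^ (i + 1) = p ^ i := by rw [pow_succ', ← mul_assoc, hQp, one_mul]
          have e2 : Q * (l0 * p ^ (j + 1)) = l0 * p ^ j := by
            rw [pow_succ']; linear_combination l0 * p ^ j * hQp
          have hy : 1 - Q * (l0 * p ^ (j + 1)) ≠ 0 := by
            rw [e2]
            refine (hA i j).resolve_right ?_
            rw [e1] at hx
            intro hne
            exact hne (by linear_combination -hx)
          simp only [ne_eq, hx, not_true_eq_false, and_false, if_false, zero_mul, zero_add]
          exact mul_div_cancel₀ _ hy
        · simp only [ne_eq, hx, not_false_eq_true, and_true, if_true, Nat.add_eq_zero_iff,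
            one_ne_zero, and_false, mul_zero, add_zero]
          field_simp
  · rintro ⟨c1, c2, rfl⟩
    rw [map_add, Finsupp.add_apply, O.E1z, O.E2z, add_zero]

end Ops

lemma root_pow {Q l : k} (hQ0 : Q ≠ 0) (hroot : ¬∃ n : ℕ, 0 < n ∧ Q ^ n = 1)
    (hl : ∃ n : ℕ, 0 < n ∧ l ^ n = 1) (m : ℕ) (h : l * Q ^ m = 1 ∨ l = Q ^ m) : m = 0 := by
  obtain ⟨n, hn, hl⟩ := hl
  by_contra hm
  apply hroot
  refine ⟨m * n, Nat.mul_pos (Nat.pos_of_ne_zero hm) hn, ?_⟩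
  rcases h with h | h
  · have := congrArg (· ^ n) h
    simp only [mul_pow, hl, one_mul, one_pow] at this
    rw [pow_mul, this]
  · rw [pow_mul, ← h, hl]

lemma cond_A {Q p l0 l1 : k} (hQp : Q * p = 1) (hroot : ¬∃ n : ℕ, 0 < n ∧ Q ^ n = 1)
    (h0 : ∃ n : ℕ, 0 < n ∧ l0 ^ n = 1) (h1 : ∃ n : ℕ, 0 < n ∧ l1 ^ n = 1)
    (hlam1 : ¬(l0 = 1 ∧ l1 = 1)) (i j : ℕ) : 1 - l0 * p ^ j ≠ 0 ∨ p ^ i - l1 ≠ 0 := by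
  have hQ0 : Q ≠ 0 := left_ne_zero_of_mul_eq_one hQp
  by_contra hc
  push Not at hc
  obtain ⟨ha, hb⟩ := hc
  have hpw : ∀ n, p ^ n * Q ^ n = 1 := fun n => by rw [← mul_pow, mul_comm, hQp, one_pow]
  have hj : j = 0 := root_pow k hQ0 hroot h0 j (Or.inr (by
    linear_combination (- Q ^ j) * ha - l0 * hpw j))
  have hi : i = 0 := root_pow k hQ0 hroot h1 i (Or.inl (by
    linear_combination (- Q ^ i) * hb + hpw i))
  subst hi hj
  apply hlam1
  constructor
  · linear_combination -ha
  · linear_combination -hb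

end Coh
section ModExt

lemma mod_ext (k : Type) [Field k] {B : Type} [Ring B] [Algebra k B] {A Y : Type}
    [AddCommGroup A] [Module B A] [AddCommGroup Y] [Module B Y]
    (D2 : B →ₗ[B] B × B) (D1 : B × B →ₗ[B] B) (De : B →ₗ[B] A) (s1 s2 t1 t2 : B)
    (hD2 : ∀ b, D2 b = (b * s1, b * s2)) (hD1 : ∀ b, D1 b = b.1 * t1 + b.2 * t2)
    (inj : ∀ b, D2 b = 0 → b = 0) (z1 : ∀ b, D1 (D2 b) = 0) (z0 : ∀ b, De (D1 b) = 0)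
    (x1 : ∀ b, D1 b = 0 → ∃ c, D2 c = b) (x0 : ∀ b, De b = 0 → ∃ c, D1 c = b)
    (sur : Function.Surjective De)
    (H0 : ∀ y : Y, t1 • y = 0 → t2 • y = 0 → y = 0)
    (H1 : ∀ y1 y2 : Y, s1 • y1 + s2 • y2 = 0 → ∃ y : Y, t1 • y = y1 ∧ t2 • y = y2)
    (l : Y →+ k) (hl : ∀ (c : k) (y : Y), l (algebraMap k B c • y) = c * l y)
    (lsur : Function.Surjective l)
    (H2 : ∀ y : Y, l y = 0 ↔ ∃ y1 y2 : Y, s1 • y1 + s2 • y2 = y) :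
    Subsingleton (((Ext k (ModuleCat.{0} B) 0).obj (Opposite.op (ModuleCat.of B A))).obj
      (ModuleCat.of B Y)) ∧
    Subsingleton (((Ext k (ModuleCat.{0} B) 1).obj (Opposite.op (ModuleCat.of B A))).obj
      (ModuleCat.of B Y)) ∧
    Module.finrank k (((Ext k (ModuleCat.{0} B) 2).obj (Opposite.op (ModuleCat.of B A))).obj
      (ModuleCat.of B Y)) = 1 ∧
    (∀ m : ℕ, 3 ≤ m → Subsingleton (((Ext k (ModuleCat.{0} B) m).obj
      (Opposite.op (ModuleCat.of B A))).obj (ModuleCat.of B Y))) := by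
  have hval : ∀ (f : B →ₗ[B] Y) (b : B), f b = b • f 1 := fun f b => by
    rw [← map_smul, smul_eq_mul, mul_one]
  have : Mono (ModuleCat.ofHom D2) := (ModuleCat.mono_iff_injective _).2
    ((injective_iff_map_eq_zero D2).2 inj)
  have : Epi (ModuleCat.ofHom De) := (ModuleCat.epi_iff_surjective _).2 sur
  have : Projective (ModuleCat.of B B) :=
    (IsProjective.iff_projective B).1 inferInstance
  have : Projective (ModuleCat.of B (B × B)) :=
    (IsProjective.iff_projective (B × B)).1 inferInstance
  let L : (ModuleCat.of B B ⟶ ModuleCat.of B Y) →ₗ[k] k :=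
    { toFun := fun f => l (f.hom (1 : B))
      map_add' := fun f g => by
        rw [← map_add]; rfl
      map_smul' := fun c f => hl c _ }
  refine kos_ext (ModuleCat.ofHom D2) (ModuleCat.ofHom D1) (ModuleCat.ofHom De) ?_ ?_ ?_ ?_ ?_ ?_
    L ?_ ?_
  · apply ModuleCat.hom_ext; exact LinearMap.ext z1
  · apply ModuleCat.hom_ext; exact LinearMap.ext z0
  · rw [ShortComplex.moduleCat_exact_iff]; exact x1
  · rw [ShortComplex.moduleCat_exact_iff]; exact x0
  · intro f hf
    have hf' : ∀ b, f.hom (D1 b) = 0 := fun b => LinearMap.congr_fun (congrArg ModuleCat.Hom.hom hf) b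
    have e : f.hom (1 : B) = 0 := by
      apply H0
      · refine (hval f.hom t1).symm.trans ?_
        have := hf' (1, 0)
        rw [hD1] at this
        simpa using this
      · refine (hval f.hom t2).symm.trans ?_
        have := hf' (0, 1)
        rw [hD1] at this
        simpa using this
    apply ModuleCat.hom_ext
    refine LinearMap.ext fun b => ?_
    refine (hval f.hom b).trans ?_
    rw [e]; exact smul_zero _
  · intro f hf
    have hf' : ∀ b, f.hom (D2 b) = 0 := fun b => LinearMap.congr_fun (congrArg ModuleCat.Hom.hom hf) b
    let F : B × B →ₗ[B] Y := f.hom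
    have hF : ∀ a b : B, F (a, b) = a • F (1, 0) + b • F (0, 1) := fun a b => by
      rw [← map_smul, ← map_smul, ← map_add]; simp
    obtain ⟨y, hy1, hy2⟩ := H1 (F (1, 0)) (F (0, 1)) (by
      rw [← hF]
      have := hf' 1
      rw [hD2, one_mul, one_mul] at this
      exact this)
    refine ⟨ModuleCat.ofHom (LinearMap.toSpanSingleton B Y y), ?_⟩
    apply ModuleCat.hom_ext
    refine LinearMap.ext fun b => ?_
    change D1 b • y = F b
    rw [hD1, add_smul, mul_smul, mul_smul, hy1, hy2, ← hF]
  · intro c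
    obtain ⟨y, hy⟩ := lsur c
    refine ⟨ModuleCat.ofHom (LinearMap.toSpanSingleton B Y y), ?_⟩
    change l ((1 : B) • y) = c
    rw [one_smul, hy]
  · intro f
    change l (f.hom (1 : B)) = 0 ↔ _
    rw [H2]
    constructor
    · rintro ⟨y1, y2, h⟩
      refine ⟨ModuleCat.ofHom (LinearMap.coprod (LinearMap.toSpanSingleton B Y y1)
        (LinearMap.toSpanSingleton B Y y2)), ?_⟩
      apply ModuleCat.hom_ext
      refine LinearMap.ext fun b => ?_
      change (D2 b).1 • y1 + (D2 b).2 • y2 = f.hom b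
      rw [hD2]
      refine Eq.trans ?_ (hval f.hom b).symm
      rw [← h, smul_add, mul_smul, mul_smul]
    · rintro ⟨c, rfl⟩
      let F : B × B →ₗ[B] Y := c.hom
      have hF : ∀ a b : B, F (a, b) = a • F (1, 0) + b • F (0, 1) := fun a b => by
        rw [← map_smul, ← map_smul, ← map_add]; simp
      refine ⟨F (1, 0), F (0, 1), ?_⟩
      rw [← hF]
      change _ = F (D2 1)
      rw [hD2, one_mul, one_mul]

end ModExt
section Fin
variable (k : Type) [Field k] (q : Fin 2 → Fin 2 → k) (lam : Fin 2 → k)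

lemma gAlg_X (i : Fin 2) : gAlg k 2 q lam (X k 2 q i) = lam i • X k 2 q i := by
  rw [gAlg, X, RingQuot.liftAlgHom_mkAlgHom_apply, FreeAlgebra.lift_ι_apply]; rfl

/-- retag an element of `A` as an element of `A_g` -/
def mkA (c : QSA k 2 q) : Ag k 2 q lam := c

lemma mkA_surj (c : Ag k 2 q lam) : ∃ b, mkA k q lam b = c := ⟨c, rfl⟩

lemma Ag_tmul (a : QSA k 2 q) (b : (QSA k 2 q)ᵐᵒᵖ) (c : QSA k 2 q) :
    (a ⊗ₜ[k] b : QSAe k 2 q) • mkA k q lam c =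
      mkA k q lam (a * c * gAlg k 2 q lam b.unop) := by
  change (taug k 2 q lam (a ⊗ₜ[k] b) : QSAe k 2 q) • (c : QSA k 2 q) = _
  rw [taug, Algebra.TensorProduct.map_tmul, TensorProduct.Algebra.smul_def]
  simp [mul_assoc, mkA]

lemma Ag_eL (i : Fin 2) (c : QSA k 2 q) :
    (eL k q i) • mkA k q lam c = mkA k q lam (X k 2 q i * c) := by
  refine (Ag_tmul k q lam (X k 2 q i) 1 c).trans ?_
  simp

lemma Ag_eR (i : Fin 2) (c : QSA k 2 q) :
    (eR k q i) • mkA k q lam c = mkA k q lam (lam i • (c * X k 2 q i)) := by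
  refine (Ag_tmul k q lam 1 (MulOpposite.op (X k 2 q i)) c).trans ?_
  simp [gAlg_X]

lemma Ag_alg (r : k) (c : QSA k 2 q) :
    (algebraMap k (QSAe k 2 q) r) • mkA k q lam c = mkA k q lam (r • c) := by
  refine (Ag_tmul k q lam (algebraMap k _ r) 1 c).trans ?_
  simp [Algebra.smul_def]

lemma Ag_sub (r : k) (a b : QSAe k 2 q) (c u v : QSA k 2 q)
    (hu : a • mkA k q lam c = mkA k q lam u)
    (hv : b • mkA k q lam c = mkA k q lam v) :
    (a - r • b) • mkA k q lam c = mkA k q lam (u - r • v) := by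
  have h1 : (a - algebraMap k (QSAe k 2 q) r * b) • mkA k q lam c =
      a • mkA k q lam c - algebraMap k (QSAe k 2 q) r • b • mkA k q lam c := by
    exact (sub_smul _ _ _).trans (congrArg _ (mul_smul _ _ _))
  rw [← Algebra.smul_def, hu, hv, Ag_alg] at h1
  exact h1

lemma Ag_sub1 (a b : QSAe k 2 q) (c u v : QSA k 2 q)
    (hu : a • mkA k q lam c = mkA k q lam u)
    (hv : b • mkA k q lam c = mkA k q lam v) :
    (a - b) • mkA k q lam c = mkA k q lam (u - v) := by
  have h := Ag_sub k q lam 1 a b c u v hu hv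
  rwa [one_smul, one_smul] at h

variable (hq1 : ∀ i, q i i = 1) (hQ : q 0 1 * q 1 0 = 1)

def phiA : Ag k 2 q lam ≃+ PB k := (phiE k q hq1 hQ).toAddEquiv

lemma phiA_eq {y : Ag k 2 q lam} {u : QSA k 2 q} (h : y = mkA k q lam u) :
    phiA k q lam hq1 hQ y = phiE k q hq1 hQ u := by subst h; rfl

def opsA : Ops k (Ag k 2 q lam) (phiA k q lam hq1 hQ) (q 0 1) (q 1 0) (lam 0) (lam 1) where
  D1 c := (eL k q 0 - eR k q 0) • c
  D2 c := (eL k q 1 - eR k q 1) • c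
  E1 c := (eR k q 1 - q 0 1 • eL k q 1) • c
  E2 c := (eL k q 0 - q 0 1 • eR k q 0) • c
  D1s c i j := by
    obtain ⟨c, rfl⟩ := mkA_surj k q lam c
    rw [phiA_eq k q lam hq1 hQ (Ag_sub1 k q lam _ _ c _ _ (Ag_eL k q lam 0 c) (Ag_eR k q lam 0 c)),
      phiA_eq k q lam hq1 hQ (rfl : mkA k q lam c = _), map_sub, map_smul, Finsupp.sub_apply,
      Finsupp.smul_apply, phi_mul_X0_succ, phiE_apply, phiL_X0_mul, pT0_apply_succ, phiE_apply,
      smul_eq_mul]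
    ring
  D1z c j := by
    obtain ⟨c, rfl⟩ := mkA_surj k q lam c
    rw [phiA_eq k q lam hq1 hQ (Ag_sub1 k q lam _ _ c _ _ (Ag_eL k q lam 0 c) (Ag_eR k q lam 0 c)),
      map_sub, map_smul, Finsupp.sub_apply,
      Finsupp.smul_apply, phi_mul_X0_zero, phiE_apply, phiL_X0_mul, pT0_apply_zero]
    simp
  D2s c i j := by
    obtain ⟨c, rfl⟩ := mkA_surj k q lam c
    rw [phiA_eq k q lam hq1 hQ (Ag_sub1 k q lam _ _ c _ _ (Ag_eL k q lam 1 c) (Ag_eR k q lam 1 c)),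
      phiA_eq k q lam hq1 hQ (rfl : mkA k q lam c = _), map_sub, map_smul, Finsupp.sub_apply,
      Finsupp.smul_apply, phi_mul_X1_succ, phiE_apply, phiL_X1_mul, pT1_apply_succ, phiE_apply,
      smul_eq_mul]
    ring
  D2z c i := by
    obtain ⟨c, rfl⟩ := mkA_surj k q lam c
    rw [phiA_eq k q lam hq1 hQ (Ag_sub1 k q lam _ _ c _ _ (Ag_eL k q lam 1 c) (Ag_eR k q lam 1 c)),
      map_sub, map_smul, Finsupp.sub_apply,
      Finsupp.smul_apply, phi_mul_X1_zero, phiE_apply, phiL_X1_mul, pT1_apply_zero]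
    simp
  E1s c i j := by
    obtain ⟨c, rfl⟩ := mkA_surj k q lam c
    rw [phiA_eq k q lam hq1 hQ (Ag_sub k q lam _ _ _ c _ _ (Ag_eR k q lam 1 c) (Ag_eL k q lam 1 c)),
      phiA_eq k q lam hq1 hQ (rfl : mkA k q lam c = _), map_sub, map_smul, map_smul, Finsupp.sub_apply,
      Finsupp.smul_apply, Finsupp.smul_apply, phi_mul_X1_succ, phiE_apply, phiE_apply,
      phiL_X1_mul, pT1_apply_succ, smul_eq_mul, smul_eq_mul]
    ring
  E1z c i := by
    obtain ⟨c, rfl⟩ := mkA_surj k q lam c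
    rw [phiA_eq k q lam hq1 hQ (Ag_sub k q lam _ _ _ c _ _ (Ag_eR k q lam 1 c) (Ag_eL k q lam 1 c)),
      map_sub, map_smul, map_smul, Finsupp.sub_apply,
      Finsupp.smul_apply, Finsupp.smul_apply, phi_mul_X1_zero, phiE_apply,
      phiL_X1_mul, pT1_apply_zero]
    simp
  E2s c i j := by
    obtain ⟨c, rfl⟩ := mkA_surj k q lam c
    rw [phiA_eq k q lam hq1 hQ (Ag_sub k q lam _ _ _ c _ _ (Ag_eL k q lam 0 c) (Ag_eR k q lam 0 c)),
      phiA_eq k q lam hq1 hQ (rfl : mkA k q lam c = _), map_sub, map_smul, map_smul, Finsupp.sub_apply,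
      Finsupp.smul_apply, Finsupp.smul_apply, phi_mul_X0_succ, phiE_apply, phiE_apply,
      phiL_X0_mul, pT0_apply_succ, smul_eq_mul, smul_eq_mul]
    ring
  E2z c j := by
    obtain ⟨c, rfl⟩ := mkA_surj k q lam c
    rw [phiA_eq k q lam hq1 hQ (Ag_sub k q lam _ _ _ c _ _ (Ag_eL k q lam 0 c) (Ag_eR k q lam 0 c)),
      map_sub, map_smul, map_smul, Finsupp.sub_apply,
      Finsupp.smul_apply, Finsupp.smul_apply, phi_mul_X0_zero, phiE_apply,
      phiL_X0_mul, pT0_apply_zero]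
    simp

end Fin

/-- Example 4.3 (first case, twisted) of the paper: for `N = 2`, `q := q_{1,2}` not a
root of unity, and `λ_1, λ_2` roots of unity not both equal to `1`, letting `g` be the
algebra automorphism of `A = S_q(V)` with `g(x_i) = λ_i x_i` and `A_g` the
correspondingly twisted `A^e`-module, one has `Ext^0_{A^e}(A, A_g) = 0`,
`Ext^1_{A^e}(A, A_g) = 0`, `Ext^2_{A^e}(A, A_g)` is 1-dimensional over `k` (spanned by
the class of `(1 # g) ⊗ x_1^* ∧ x_2^*`), and `Ext^m_{A^e}(A, A_g) = 0` for `m ≥ 3`. -/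
theorem stmt19 (k : Type) [Field k] [CharZero k]
    (q : Fin 2 → Fin 2 → k) (hq0 : ∀ i j, q i j ≠ 0) (hq1 : ∀ i, q i i = 1)
    (hqinv : ∀ i j, q j i = (q i j)⁻¹)
    (hroot : ¬∃ n : ℕ, 0 < n ∧ q 0 1 ^ n = 1)
    (lam : Fin 2 → k) (hlamroot : ∀ i, ∃ n : ℕ, 0 < n ∧ lam i ^ n = 1)
    (hlam1 : ¬(lam 0 = 1 ∧ lam 1 = 1)) :
    Subsingleton (HHg k 2 q lam 0) ∧
    Subsingleton (HHg k 2 q lam 1) ∧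
    Module.finrank k (HHg k 2 q lam 2) = 1 ∧
    (∀ m : ℕ, 3 ≤ m → Subsingleton (HHg k 2 q lam m)) := by
  have hQ : q 0 1 * q 1 0 = 1 := by
    rw [hqinv 0 1]; exact mul_inv_cancel₀ (hq0 0 1)
  have hA := cond_A k hQ hroot (hlamroot 0) (hlamroot 1) hlam1
  have hB : lam 1 ≠ q 0 1 := fun h => one_ne_zero
    (root_pow k (hq0 0 1) hroot (hlamroot 1) 1 (Or.inr (by rw [pow_one]; exact h)))
  have hC : q 0 1 * lam 0 ≠ 1 := fun h => one_ne_zero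
    (root_pow k (hq0 0 1) hroot (hlamroot 0) 1 (Or.inl (by rw [pow_one, mul_comm]; exact h)))
  let K := KD k q hq1 hQ
  let O := opsA k q lam hq1 hQ
  let l : Ag k 2 q lam →+ k :=
    (Finsupp.applyAddHom ((0, 0) : ℕ × ℕ)).comp (phiA k q lam hq1 hQ).toAddMonoidHom
  refine mod_ext k K.D2 K.D1 (De k q) (eR k q 1 - q 0 1 • eL k q 1) (eL k q 0 - q 0 1 • eR k q 0)
    (eL k q 0 - eR k q 0) (eL k q 1 - eR k q 1) K.D2_apply K.D1_apply
    (fun b hb => K.D2_inj (hb.trans (map_zero _).symm)) K.D1_D2 (De_D1 k q hq1 hQ)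
    K.D1_exact (De_exact k q hq1 hQ) (De_surj k q)
    (O.H0 hA) (O.H1 hQ hA hB hC) l ?_ ?_ (O.H2 hQ hA hB hC)
  · intro c y
    obtain ⟨y, rfl⟩ := mkA_surj k q lam y
    change phiA k q lam hq1 hQ _ (0, 0) = c * phiA k q lam hq1 hQ y (0, 0)
    rw [phiA_eq k q lam hq1 hQ (Ag_alg k q lam c y), map_smul]
    rfl
  · intro c
    refine ⟨(phiA k q lam hq1 hQ).symm (Finsupp.single (0, 0) c), ?_⟩
    change phiA k q lam hq1 hQ _ (0, 0) = c
    rw [AddEquiv.apply_symm_apply, Finsupp.single_eq_same]
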